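/- For any fixed constant c ≥ 0, the limit as x → ∞ of e^{-x} · Σ_{n=0}^∞ (1 - 1/x)^{c n} I_n(x) equals 1/2, where I_n is the modified Bessel function of the first kind. -/

import Mathlib

/-- Modified Bessel function of the first kind of integer order,
via the integral representation `I_n(x) = (1/π) ∫_0^π e^{x cos θ} cos(n θ) dθ`. -/
noncomputable def besselI (n : ℤ) (x : ℝ) : ℝ :=
  (1 / Real.pi) * ∫ θ in (0:ℝ)..Real.pi, Real.exp (x * Real.cos θ) * Real.cos ((n : ℝ) * θ)

/-- The `n`-th cosine moment of `cos θ ^ k`: the probability that a simple random walk on `ℤ`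
started at the origin is at `n` after `k` steps. -/
noncomputable def cosMoment (k : ℕ) (n : ℤ) : ℝ :=
  (1 / Real.pi) * ∫ θ in (0:ℝ)..Real.pi, Real.cos θ ^ k * Real.cos ((n : ℝ) * θ)

theorem cosMoment_zero (n : ℤ) : cosMoment 0 n = if n = 0 then 1 else 0 := by
  unfold cosMoment
  split_ifs with h
  · simp [h, Real.pi_ne_zero]
  · have h' : (n : ℝ) ≠ 0 := by exact_mod_cast h
    simp [intervalIntegral.integral_comp_mul_left (fun θ => Real.cos θ) h', Real.sin_int_mul_pi]

theorem cosMoment_succ (k : ℕ) (n : ℤ) :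
    cosMoment (k + 1) n = (cosMoment k (n + 1) + cosMoment k (n - 1)) / 2 := by
  unfold cosMoment
  rw [← mul_add, ← intervalIntegral.integral_add
    (Continuous.intervalIntegrable (by fun_prop) _ _)
    (Continuous.intervalIntegrable (by fun_prop) _ _), mul_div_assoc,
    ← intervalIntegral.integral_div]
  congr 2
  ext θ
  push_cast
  rw [add_mul, sub_mul, one_mul, Real.cos_add, Real.cos_sub]
  ring

theorem cosMoment_nonneg (k : ℕ) (n : ℤ) : 0 ≤ cosMoment k n := by
  induction k generalizing n with
  | zero => rw [cosMoment_zero]; split_ifs <;> norm_num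
  | succ k ih => rw [cosMoment_succ]; linarith [ih (n + 1), ih (n - 1)]

theorem hasSum_cosMoment (k : ℕ) : HasSum (cosMoment k) 1 := by
  induction k with
  | zero =>
    have h : cosMoment 0 = fun n => if n = 0 then 1 else 0 := funext cosMoment_zero
    rw [h]
    exact hasSum_ite_eq 0 1
  | succ k ih =>
    have h₁ : HasSum (fun n => cosMoment k (n + 1)) 1 :=
      by
      simpa [Function.comp_def] using (Equiv.addRight (1 : ℤ)).hasSum_iff.mpr ih
    have h₂ : HasSum (fun n => cosMoment k (n - 1)) 1 :=
      by
      simpa [Function.comp_def] using (Equiv.subRight (1 : ℤ)).hasSum_iff.mpr ih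
    have h := (h₁.add h₂).div_const 2
    norm_num at h
    exact h.congr_fun (cosMoment_succ k)

theorem hasSum_besselI_cosMoment (n : ℤ) (x : ℝ) :
    HasSum (fun k : ℕ => x ^ k / (k.factorial : ℝ) * cosMoment k n) (besselI n x) := by
  have key : HasSum (fun k : ℕ => ∫ θ in (0:ℝ)..Real.pi,
      x ^ k / (k.factorial : ℝ) * (Real.cos θ ^ k * Real.cos ((n : ℝ) * θ)))
      (∫ θ in (0:ℝ)..Real.pi, Real.exp (x * Real.cos θ) * Real.cos ((n : ℝ) * θ)) := by
    refine intervalIntegral.hasSum_integral_of_dominated_convergence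
      (fun k _ => |x| ^ k / (k.factorial : ℝ)) ?_ ?_ ?_ ?_ ?_
    · intro k
      exact Continuous.aestronglyMeasurable (by fun_prop)
    · intro k
      refine Filter.Eventually.of_forall fun θ _ => ?_
      rw [norm_mul, norm_mul, norm_div, norm_pow, norm_pow, Real.norm_natCast]
      simp only [Real.norm_eq_abs]
      have h : |Real.cos θ| ^ k * |Real.cos (n * θ)| ≤ 1 :=
        mul_le_one₀ (pow_le_one₀ (abs_nonneg _) (Real.abs_cos_le_one _)) (abs_nonneg _)
          (Real.abs_cos_le_one _)
      exact mul_le_of_le_one_right (by positivity) h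
    · exact Filter.Eventually.of_forall fun θ _ => Real.summable_pow_div_factorial _
    · exact intervalIntegrable_const
    · refine Filter.Eventually.of_forall fun θ _ => ?_
      have h := (NormedSpace.expSeries_div_hasSum_exp (x * Real.cos θ)).mul_right
        (Real.cos ((n : ℝ) * θ))
      rw [← Real.exp_eq_exp_ℝ] at h
      refine h.congr_fun fun k => ?_
      rw [mul_pow]
      ring
  refine (key.mul_left (1 / Real.pi)).congr_fun fun k => ?_
  rw [intervalIntegral.integral_const_mul, cosMoment]
  ring

theorem besselI_nonneg (n : ℤ) {x : ℝ} (hx : 0 ≤ x) : 0 ≤ besselI n x :=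
  (hasSum_besselI_cosMoment n x).nonneg fun k =>
    mul_nonneg (by positivity) (cosMoment_nonneg k n)

theorem besselI_neg (n : ℤ) (x : ℝ) : besselI (-n) x = besselI n x := by
  simp [besselI, neg_mul, Real.cos_neg]

/-- The generating function of the modified Bessel functions at `t = 1`. -/
theorem hasSum_besselI_int {x : ℝ} (hx : 0 ≤ x) :
    HasSum (fun n : ℤ => besselI n x) (Real.exp x) := by
  have hrow (k : ℕ) : HasSum (fun n : ℤ => x ^ k / (k.factorial : ℝ) * cosMoment k n)
      (x ^ k / (k.factorial : ℝ)) := by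
    simpa using (hasSum_cosMoment k).mul_left (x ^ k / (k.factorial : ℝ))
  have hexp : HasSum (fun k : ℕ => x ^ k / (k.factorial : ℝ)) (Real.exp x) := by
    rw [Real.exp_eq_exp_ℝ]
    exact NormedSpace.expSeries_div_hasSum_exp x
  have hsum : Summable fun p : ℕ × ℤ =>
      x ^ p.1 / (p.1.factorial : ℝ) * cosMoment p.1 p.2 := by
    refine (summable_prod_of_nonneg fun p =>
      mul_nonneg (by positivity) (cosMoment_nonneg p.1 p.2)).mpr
      ⟨fun k => (hrow k).summable, ?_⟩
    exact hexp.summable.congr fun k => (hrow k).tsum_eq.symm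
  have htot : HasSum (fun p : ℕ × ℤ =>
      x ^ p.1 / (p.1.factorial : ℝ) * cosMoment p.1 p.2) (Real.exp x) := by
    rw [← (hsum.hasSum.prod_fiberwise hrow).unique hexp]
    exact hsum.hasSum
  exact HasSum.prod_fiberwise ((Equiv.prodComm ℤ ℕ).hasSum_iff.mpr htot)
    fun n => hasSum_besselI_cosMoment n x

theorem hasSum_besselI_nat {x : ℝ} (hx : 0 ≤ x) :
    HasSum (fun n : ℕ => besselI n x) ((Real.exp x + besselI 0 x) / 2) := by
  refine ((hasSum_besselI_int hx).nat_add_neg.div_const 2).congr_fun fun n => ?_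
  rw [besselI_neg]
  ring

theorem besselI_recurrence (n : ℤ) (x : ℝ) :
    n * besselI n x = x / 2 * (besselI (n - 1) x - besselI (n + 1) x) := by
  have hint : ∫ θ in (0:ℝ)..Real.pi,
      ((n : ℝ) * (Real.exp (x * Real.cos θ) * Real.cos (n * θ)) - x / 2 *
        (Real.exp (x * Real.cos θ) * Real.cos (((n - 1 : ℤ) : ℝ) * θ) -
          Real.exp (x * Real.cos θ) * Real.cos (((n + 1 : ℤ) : ℝ) * θ))) = 0 := by
    rw [intervalIntegral.integral_eq_sub_of_hasDerivAt
      (f := fun θ => Real.exp (x * Real.cos θ) * Real.sin (n * θ)) ?_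
      (Continuous.intervalIntegrable (by fun_prop) _ _)]
    · simp [Real.sin_int_mul_pi]
    · intro θ _
      have h := ((Real.hasDerivAt_cos θ).const_mul x).exp.mul
        (((hasDerivAt_id θ).const_mul (n : ℝ)).sin)
      refine h.congr_deriv ?_
      push_cast
      simp only [id]
      rw [add_mul, sub_mul, one_mul, Real.cos_add, Real.cos_sub]
      ring
  rw [intervalIntegral.integral_sub (Continuous.intervalIntegrable (by fun_prop) _ _)
      (Continuous.intervalIntegrable (by fun_prop) _ _),
    intervalIntegral.integral_const_mul, intervalIntegral.integral_const_mul,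
    intervalIntegral.integral_sub (Continuous.intervalIntegrable (by fun_prop) _ _)
      (Continuous.intervalIntegrable (by fun_prop) _ _)] at hint
  unfold besselI
  linear_combination (1 / Real.pi) * hint

theorem sum_range_nat_mul_besselI_le (N : ℕ) {x : ℝ} (hx : 0 ≤ x) :
    ∑ n ∈ Finset.range N, (n : ℝ) * besselI n x ≤ x / 2 * (besselI 0 x + besselI 1 x) := by
  have h : ∑ n ∈ Finset.range N, (n : ℝ) * besselI n x =
      x / 2 * (besselI 0 x + besselI 1 x) - x / 2 * (besselI N x + besselI (N - 1) x) := by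
    induction N with
    | zero =>
      have := besselI_neg 1 x
      simp [this]
    | succ N ih =>
      have := besselI_recurrence N x
      push_cast at this ⊢
      rw [Finset.sum_range_succ, ih, this, add_sub_cancel_right]
      ring
  rw [h]
  have := besselI_nonneg N hx
  have := besselI_nonneg (N - 1) hx
  have : 0 ≤ x / 2 * (besselI N x + besselI (N - 1) x) := by positivity
  linarith

theorem tendsto_exp_neg_mul_besselI (n : ℤ) :
    Filter.Tendsto (fun x : ℝ => Real.exp (-x) * besselI n x) Filter.atTop (nhds 0) := by
  have h : Filter.Tendsto (fun x : ℝ => ∫ θ in (0:ℝ)..Real.pi,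
      Real.exp (x * (Real.cos θ - 1)) * Real.cos ((n : ℝ) * θ)) Filter.atTop
      (nhds (∫ _ in (0:ℝ)..Real.pi, (0 : ℝ))) := by
    refine intervalIntegral.tendsto_integral_filter_of_dominated_convergence (fun _ => 1)
      (Filter.Eventually.of_forall fun x => Continuous.aestronglyMeasurable (by fun_prop))
      ?_ intervalIntegrable_const ?_
    · filter_upwards [Filter.eventually_ge_atTop 0] with x hx
      refine Filter.Eventually.of_forall fun θ _ => ?_
      rw [norm_mul, Real.norm_eq_abs, Real.norm_eq_abs, Real.abs_exp]
      refine mul_le_one₀ (Real.exp_le_one_iff.mpr ?_) (abs_nonneg _) (Real.abs_cos_le_one _)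
      exact mul_nonpos_of_nonneg_of_nonpos hx (by linarith [Real.cos_le_one θ])
    · refine Filter.Eventually.of_forall fun θ hθ => ?_
      rw [Set.uIoc_of_le Real.pi_pos.le] at hθ
      have hcos : Real.cos θ - 1 < 0 := by
        have := Real.cos_lt_cos_of_nonneg_of_le_pi le_rfl hθ.2 hθ.1
        rw [Real.cos_zero] at this
        linarith
      have := (Real.tendsto_exp_atBot.comp
        (Filter.tendsto_id.atTop_mul_const_of_neg hcos)).mul_const (Real.cos ((n : ℝ) * θ))
      simpa using this
  have h' := h.const_mul (1 / Real.pi)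
  simp only [intervalIntegral.integral_zero, mul_zero] at h'
  refine h'.congr fun x => ?_
  rw [besselI, mul_left_comm, ← intervalIntegral.integral_const_mul (Real.exp (-x))]
  congr 1
  refine intervalIntegral.integral_congr fun θ _ => ?_
  rw [← mul_assoc, ← Real.exp_add]
  ring_nf

theorem one_sub_le_one_sub_inv_rpow {a x : ℝ} (ha : 0 ≤ a) (hx : 2 ≤ x) :
    1 - 2 * a / x ≤ (1 - 1 / x) ^ a := by
  have hx0 : 0 < x := by linarith
  have hinv : 1 / x ≤ 1 / 2 := one_div_le_one_div_of_le (by norm_num) hx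
  have hpos : 0 < 1 - 1 / x := by linarith
  have hlog : -(2 / x) ≤ Real.log (1 - 1 / x) := by
    refine le_trans ?_ (Real.one_sub_inv_le_log_of_pos hpos)
    have : 1 - (1 - 1 / x)⁻¹ = -(1 / (x - 1)) := by
      have : x - 1 ≠ 0 := by linarith
      field_simp
      ring
    rw [this, neg_le_neg_iff, div_le_div_iff₀ (by linarith) hx0]
    linarith
  rw [Real.rpow_def_of_pos hpos]
  have h := mul_le_mul_of_nonneg_right hlog ha
  have := Real.add_one_le_exp (Real.log (1 - 1 / x) * a)
  have : 2 * a / x = 2 / x * a := by ring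
  linarith

theorem stmt1 (c : ℝ) (hc : 0 ≤ c) :
    Filter.Tendsto
      (fun x : ℝ => Real.exp (-x) * ∑' n : ℕ, (1 - 1/x) ^ (c * (n : ℝ)) * besselI n x)
      Filter.atTop (nhds (1/2)) := by
  have h₀ := tendsto_exp_neg_mul_besselI 0
  have h₁ := tendsto_exp_neg_mul_besselI 1
  have hupper : Filter.Tendsto (fun x : ℝ => 1 / 2 + Real.exp (-x) * besselI 0 x / 2)
      Filter.atTop (nhds (1 / 2)) := by
    simpa only [zero_div, add_zero] using (h₀.div_const 2).const_add (1 / 2)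
  have hlower : Filter.Tendsto (fun x : ℝ => 1 / 2 + Real.exp (-x) * besselI 0 x / 2 -
      c * (Real.exp (-x) * besselI 0 x + Real.exp (-x) * besselI 1 x))
      Filter.atTop (nhds (1 / 2)) := by
    simpa using hupper.sub ((h₀.add h₁).const_mul c)
  refine tendsto_of_tendsto_of_tendsto_of_le_of_le' hlower hupper ?_ ?_
  all_goals
    filter_upwards [Filter.eventually_ge_atTop 2] with x hx
    have hx0 : 0 ≤ x := by linarith
    have hinv : 1 / x ≤ 1 / 2 := one_div_le_one_div_of_le (by norm_num) hx
    have hI (n : ℕ) : 0 ≤ besselI n x := besselI_nonneg n hx0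
    have hle (n : ℕ) : (1 - 1 / x) ^ (c * (n : ℝ)) * besselI n x ≤ besselI n x :=
      mul_le_of_le_one_left (hI n) (Real.rpow_le_one (by linarith)
        (by linarith [one_div_nonneg.mpr hx0]) (by positivity))
    have hsumI := hasSum_besselI_nat hx0
    have hsum : Summable fun n : ℕ => (1 - 1 / x) ^ (c * (n : ℝ)) * besselI n x :=
      hsumI.summable.of_nonneg_of_le
        (fun n => mul_nonneg (Real.rpow_nonneg (by linarith) _) (hI n)) hle
    have hexp : Real.exp (-x) * Real.exp x = 1 := by rw [← Real.exp_add]; simp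
  · have hnI (n : ℕ) : 0 ≤ (n : ℝ) * besselI n x := mul_nonneg n.cast_nonneg (hI n)
    have hsumn : Summable fun n : ℕ => (n : ℝ) * besselI n x :=
      summable_of_sum_range_le hnI fun N => sum_range_nat_mul_besselI_le N hx0
    have hbound : ∑' n : ℕ, (n : ℝ) * besselI n x ≤ x / 2 * (besselI 0 x + besselI 1 x) :=
      Real.tsum_le_of_sum_range_le hnI fun N => sum_range_nat_mul_besselI_le N hx0
    have hlow : (Real.exp x + besselI 0 x) / 2 - 2 * c / x * ∑' n : ℕ, (n : ℝ) * besselI n x ≤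
        ∑' n : ℕ, (1 - 1 / x) ^ (c * (n : ℝ)) * besselI n x := by
      refine hasSum_le (fun n => ?_) (hsumI.sub (hsumn.hasSum.mul_left (2 * c / x))) hsum.hasSum
      have h := mul_le_mul_of_nonneg_right
        (one_sub_le_one_sub_inv_rpow (a := c * n) (by positivity) hx) (hI n)
      refine le_trans (le_of_eq ?_) h
      ring
    have hmul : 2 * c / x * ∑' n : ℕ, (n : ℝ) * besselI n x ≤
        c * (besselI 0 x + besselI 1 x) := by
      refine (mul_le_mul_of_nonneg_left hbound (by positivity)).trans_eq ?_
      field_simp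
    have := mul_le_mul_of_nonneg_left (hlow.trans' (sub_le_sub_left hmul _))
      (Real.exp_pos (-x)).le
    refine le_trans (le_of_eq ?_) this
    linear_combination (-1 / 2) * hexp
  · have := mul_le_mul_of_nonneg_left (hasSum_le hle hsum.hasSum hsumI) (Real.exp_pos (-x)).le
    refine this.trans_eq ?_
    linear_combination (1 / 2) * hexp
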